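/- Let m₁, …, m₈ be eight distinct lines in Pic S₈ that pairwise intersect in 0 (the vertices of a 7-simplex), with sum D₁ = m₁ + ⋯ + m₈, and partition them into four pairs with sums a₁ = m₁ + m₂, a₂ = m₃ + m₄, a₃ = m₅ + m₆, a₄ = m₇ + m₈. Then the classes n₁, …, n₄ determined by 3nᵢ = (D₁ − K) − 3aᵢ are lines satisfying nᵢ·nⱼ = 1 for i ≠ j, they form an uncornered A₃⁸(1)-polytope, and their center D = n₁ + n₂ + n₃ + n₄ satisfies 3D + 4K = D₁. -/

import Mathlib

/-!
Picard lattice of the degree 1 del Pezzo surface S₈: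
Pic S₈ = ℤh ⊕ ℤe₁ ⊕ ⋯ ⊕ ℤe₈ ≅ ℤ⁹, with intersection pairing
h·h = 1, h·eᵢ = 0, eᵢ·eⱼ = −δᵢⱼ, and canonical class K = −3h + e₁ + ⋯ + e₈.
-/

namespace DelPezzo

/-- The Picard lattice `Pic S₈ ≅ ℤ⁹`; coordinate `0` is the `h`-coordinate and
coordinates `1,…,8` are the `e₁,…,e₈`-coordinates. -/
abbrev Pic : Type := Fin 9 → ℤ

/-- The intersection pairing on `Pic S₈` (signature `(1,-8)`). -/
def inter (x y : Pic) : ℤ := x 0 * y 0 - ∑ i : Fin 8, x i.succ * y i.succ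

/-- The canonical class `K = -3h + e₁ + ⋯ + e₈`. -/
def K : Pic := fun i => if i = 0 then -3 else 1

/-- A line: a class `l` with `l·l = -1` and `l·K = -1`. -/
def IsLine (l : Pic) : Prop := inter l l = -1 ∧ inter l K = -1

theorem inter_comm (x y : Pic) : inter x y = inter y x := by
  simp only [inter, mul_comm]

theorem inter_add_left (x y z : Pic) : inter (x + y) z = inter x z + inter y z := by
  simp only [inter, Pi.add_apply, add_mul, Finset.sum_add_distrib]
  ring

theorem inter_smul_left (c : ℤ) (x y : Pic) : inter (c • x) y = c * inter x y := by
  simp only [inter, Pi.smul_apply, smul_eq_mul, mul_sub, Finset.mul_sum, mul_assoc]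

theorem inter_sub_left (x y z : Pic) : inter (x - y) z = inter x z - inter y z := by
  simp only [inter, Pi.sub_apply, sub_mul, Finset.sum_sub_distrib]
  ring

theorem inter_add_right (x y z : Pic) : inter x (y + z) = inter x y + inter x z := by
  simp only [inter_comm x, inter_add_left]

theorem inter_smul_right (c : ℤ) (x y : Pic) : inter x (c • y) = c * inter x y := by
  simp only [inter_comm x, inter_smul_left]

theorem inter_sub_right (x y z : Pic) : inter x (y - z) = inter x y - inter x z := by
  simp only [inter_comm x, inter_sub_left]

theorem inter_sum_left {ι : Type*} (s : Finset ι) (f : ι → Pic) (y : Pic) :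
    inter (∑ i ∈ s, f i) y = ∑ i ∈ s, inter (f i) y := by
  classical
  induction s using Finset.induction_on with
  | empty => simp [inter]
  | insert a s ha ih => rw [Finset.sum_insert ha, Finset.sum_insert ha, inter_add_left, ih]

theorem inter_sum_right {ι : Type*} (s : Finset ι) (f : ι → Pic) (x : Pic) :
    inter x (∑ i ∈ s, f i) = ∑ i ∈ s, inter x (f i) := by
  simp only [inter_comm x, inter_sum_left]

theorem inter_K_K : inter K K = 1 := by
  simp [inter, K]

/-- The intersection form is negative semidefinite on the orthogonal complement of `K`. -/
theorem inter_self_nonpos_of_inter_K_eq_zero {y : Pic} (h : inter y K = 0) :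
    inter y y ≤ 0 := by
  have hsum : ∑ i : Fin 8, y i.succ = -3 * y 0 := by
    simp [inter, K] at h
    linarith
  have hcs := sq_sum_le_card_mul_sum_sq (s := Finset.univ) (f := fun i : Fin 8 => y i.succ)
  rw [hsum] at hcs
  simp only [Finset.card_univ, Fintype.card_fin, Nat.cast_ofNat] at hcs
  simp only [inter, ← pow_two]
  nlinarith [sq_nonneg (y 0)]

/-- Integers that sum to `-1` have squares summing to at least `1`. -/
theorem one_le_sq_add_sq {a b : ℤ} (h : a + b = -1) : 1 ≤ a ^ 2 + b ^ 2 := by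
  obtain rfl : b = -1 - a := by linarith
  by_contra! hlt
  have : a = 0 := by nlinarith
  subst this
  norm_num at hlt

theorem skew_edges_give_uncornered_simplex (m : Fin 8 → Pic)
    (hinj : Function.Injective m)
    (hline : ∀ i, IsLine (m i))
    (hint : ∀ i j, i ≠ j → inter (m i) (m j) = 0)
    (n : Fin 4 → Pic)
    (hn0 : 3 • n 0 = (∑ i, m i) - K - 3 • (m 0 + m 1))
    (hn1 : 3 • n 1 = (∑ i, m i) - K - 3 • (m 2 + m 3))
    (hn2 : 3 • n 2 = (∑ i, m i) - K - 3 • (m 4 + m 5))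
    (hn3 : 3 • n 3 = (∑ i, m i) - K - 3 • (m 6 + m 7)) :
    (∀ i, IsLine (n i)) ∧
    (∀ i j, i ≠ j → inter (n i) (n j) = 1) ∧
    Function.Injective n ∧
    (¬ ∃ x : Pic, IsLine x ∧ ∀ i, inter x (n i) = 0) ∧
    3 • (∑ i, n i) + 4 • K = ∑ i, m i := by
  have hm : ∀ i j, inter (m i) (m j) = if i = j then -1 else 0 := by
    intro i j
    split_ifs with hij
    · rw [← hij, (hline i).1]
    · exact hint i j hij
  have hmK : ∀ i, inter (m i) K = -1 := fun i => (hline i).2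
  have hKm : ∀ i, inter K (m i) = -1 := fun i => by rw [inter_comm, hmK]
  obtain ⟨H, hH⟩ : ∃ H : Pic, (3 : ℤ) • H = (∑ i, m i) - K :=
    ⟨n 0 + (m 0 + m 1), by
      rw [smul_add]
      exact eq_sub_iff_add_eq.mp (by exact_mod_cast hn0)⟩
  have hHm : ∀ i, inter H (m i) = 0 := by
    intro i
    have h := congrArg (inter · (m i)) hH
    simp [-zsmul_eq_mul, inter_smul_left, inter_sub_left, inter_sum_left, hm, hKm] at h
    exact h
  have hmH : ∀ i, inter (m i) H = 0 := fun i => by rw [inter_comm, hHm]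
  have hHK : inter H K = -3 := by
    have h := congrArg (inter · K) hH
    simp [-zsmul_eq_mul, inter_smul_left, inter_sub_left, inter_sum_left, hmK, inter_K_K] at h
    linarith
  have hHH : inter H H = 1 := by
    have h := congrArg (inter H ·) hH
    simp [-zsmul_eq_mul, inter_smul_right, inter_sub_right, inter_sum_right, hHm, hHK] at h
    linarith
  have hcancel : ∀ v w : Pic, 3 • v = (∑ i, m i) - K - 3 • w → v = H - w := by
    intro v w h
    rw [← hH] at h
    funext t
    have ht := congrFun h t
    simp at ht ⊢
    linarith
  have hn : ∀ k, n k = ![H - (m 0 + m 1), H - (m 2 + m 3), H - (m 4 + m 5),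
      H - (m 6 + m 7)] k := by
    intro k
    fin_cases k
    · exact hcancel _ _ hn0
    · exact hcancel _ _ hn1
    · exact hcancel _ _ hn2
    · exact hcancel _ _ hn3
  have hnn : ∀ i j, inter (n i) (n j) = if i = j then -1 else 1 := by
    intro i j
    rw [hn, hn]
    fin_cases i <;> fin_cases j <;>
      simp [inter_sub_left, inter_sub_right, inter_add_left, inter_add_right, hm, hmH, hHm, hHH]
  refine ⟨fun i => ⟨by simp [hnn], ?_⟩, fun i j hij => by simp [hnn, hij], ?_, ?_, ?_⟩
  · rw [hn]
    fin_cases i <;> simp [inter_sub_left, inter_add_left, hmK, hHK]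
  · intro i j hij
    by_contra hne
    have h := hnn i j
    rw [hij, hnn, if_pos rfl, if_neg hne] at h
    norm_num at h
  · rintro ⟨x, ⟨hxx, hxK⟩, hx⟩
    have hxH : 3 * inter x H = (∑ i, inter x (m i)) + 1 := by
      rw [← inter_smul_right, hH, inter_sub_right, inter_sum_right, hxK]
      ring
    have h0 := hx 0
    have h1 := hx 1
    have h2 := hx 2
    have h3 := hx 3
    simp [hn, inter_sub_right, inter_add_right] at h0 h1 h2 h3
    rw [Fin.sum_univ_eight] at hxH
    have hxH' : inter x H = -1 := by linarith
    have hsum : ∑ i, inter x (m i) = -4 := by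
      rw [Fin.sum_univ_eight]
      linarith
    have hsq := inter_self_nonpos_of_inter_K_eq_zero
      (y := x + H + ∑ i, inter x (m i) • m i) (by
        simp [-zsmul_eq_mul, inter_add_left, inter_sum_left, inter_smul_left, hmK, hxK, hHK, hsum])
    simp [-zsmul_eq_mul, inter_add_left, inter_add_right, inter_sum_left, inter_sum_right, inter_smul_left,
      inter_smul_right, hm, hmH, hHm, hHH, hxx, hxH', inter_comm H x, inter_comm (m _) x] at hsq
    simp only [Fin.sum_univ_eight] at hsq
    have q0 := one_le_sq_add_sq (a := inter x (m 0)) (b := inter x (m 1)) (by linarith)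
    have q1 := one_le_sq_add_sq (a := inter x (m 2)) (b := inter x (m 3)) (by linarith)
    have q2 := one_le_sq_add_sq (a := inter x (m 4)) (b := inter x (m 5)) (by linarith)
    have q3 := one_le_sq_add_sq (a := inter x (m 6)) (b := inter x (m 7)) (by linarith)
    linarith
  · rw [Fin.sum_univ_four, smul_add, smul_add, smul_add, hn0, hn1, hn2, hn3, Fin.sum_univ_eight]
    module

end DelPezzo
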